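/- Let G be a finite subgroup of GL_m(ℚ). Then G is maximal finite (i.e., every finite subgroup of GL_m(ℚ) containing G equals G) if and only if G = Aut(L, F) for every full G-invariant lattice L and every F ∈ F_{>0}(G). -/

import Mathlib

open Matrix
open scoped MatrixGroups

/-- A symmetric positive definite rational matrix. -/
def IsPosDefForm {m : ℕ} (F : Matrix (Fin m) (Fin m) ℚ) : Prop :=
  Fᵀ = F ∧ ∀ v : Fin m → ℚ, v ≠ 0 → 0 < v ⬝ᵥ F.mulVec v

/-- `F` is a `G`-invariant form: `g * F * gᵀ = F` for all `g ∈ G`. -/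
def IsInvariantForm {m : ℕ} (G : Subgroup (GL (Fin m) ℚ)) (F : Matrix (Fin m) (Fin m) ℚ) : Prop :=
  ∀ g ∈ G, (g : Matrix (Fin m) (Fin m) ℚ) * F * (g : Matrix (Fin m) (Fin m) ℚ)ᵀ = F

/-- A full `G`-invariant lattice in the row space `ℚ^{1×m}`. -/
def IsFullInvariantLattice {m : ℕ} (G : Subgroup (GL (Fin m) ℚ))
    (L : Submodule ℤ (Fin m → ℚ)) : Prop :=
  L.FG ∧ Submodule.span ℚ (L : Set (Fin m → ℚ)) = ⊤ ∧
    ∀ g ∈ G, ∀ v ∈ L, v ᵥ* (g : Matrix (Fin m) (Fin m) ℚ) ∈ L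

/-- The automorphism group `Aut(L, F) = {g ∈ GL_m(ℚ) : L·g = L, g·F·gᵀ = F}`, as a set. -/
def autSet {m : ℕ} (L : Submodule ℤ (Fin m → ℚ)) (F : Matrix (Fin m) (Fin m) ℚ) :
    Set (GL (Fin m) ℚ) :=
  {g | (fun v => v ᵥ* (g : Matrix (Fin m) (Fin m) ℚ)) '' (L : Set (Fin m → ℚ)) =
        (L : Set (Fin m → ℚ)) ∧
      (g : Matrix (Fin m) (Fin m) ℚ) * F * (g : Matrix (Fin m) (Fin m) ℚ)ᵀ = F}

/-- A finitely generated lattice in `ℚ^m` has a common denominator. -/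
theorem Submodule.FG.exists_common_denominator {m : ℕ} {L : Submodule ℤ (Fin m → ℚ)}
    (hL : L.FG) : ∃ N : ℤ, N ≠ 0 ∧ ∀ v ∈ L, ∀ i, ∃ k : ℤ, (k : ℚ) = N * v i := by
  obtain ⟨S, rfl⟩ := hL
  obtain ⟨N, hN⟩ := IsLocalization.exist_integer_multiples_of_finite (nonZeroDivisors ℤ)
    (fun p : S × Fin m => (p.1 : Fin m → ℚ) p.2)
  refine ⟨N, nonZeroDivisors.ne_zero N.2, fun v hv i => ?_⟩
  induction hv using Submodule.span_induction with
  | mem x hx =>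
    obtain ⟨k, hk⟩ := hN (⟨x, hx⟩, i)
    exact ⟨k, by simpa using hk⟩
  | zero => exact ⟨0, by simp⟩
  | add x y _ _ hx hy =>
    obtain ⟨a, ha⟩ := hx
    obtain ⟨b, hb⟩ := hy
    exact ⟨a + b, by push_cast; rw [ha, hb, Pi.add_apply]; ring⟩
  | smul c x _ hx =>
    obtain ⟨a, ha⟩ := hx
    exact ⟨c * a, by push_cast; rw [ha, Pi.smul_apply, zsmul_eq_mul]; ring⟩

/-- A finitely generated lattice in `ℚ^m` has only finitely many vectors with bounded
coordinates. -/
theorem Submodule.FG.finite_setOf_sq_le {m : ℕ} {L : Submodule ℤ (Fin m → ℚ)}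
    (hL : L.FG) (b : Fin m → ℚ) : {v | v ∈ L ∧ ∀ i, v i ^ 2 ≤ b i}.Finite := by
  obtain ⟨N, hN, hk⟩ := hL.exists_common_denominator
  have hNQ : (N : ℚ) ≠ 0 := by exact_mod_cast hN
  refine (Set.Finite.pi' fun i => (Set.finite_Icc (-⌈(N : ℚ) ^ 2 * b i⌉)
    ⌈(N : ℚ) ^ 2 * b i⌉).image fun k : ℤ => (k : ℚ) / N).subset ?_
  rintro v ⟨hv, hb⟩ i
  obtain ⟨k, hkv⟩ := hk v hv i
  have hsq : k ^ 2 ≤ ⌈(N : ℚ) ^ 2 * b i⌉ := by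
    have h : ((k ^ 2 : ℤ) : ℚ) ≤ (N : ℚ) ^ 2 * b i := by
      push_cast
      rw [hkv, mul_pow]
      exact mul_le_mul_of_nonneg_left (hb i) (sq_nonneg _)
    exact_mod_cast h.trans (Int.le_ceil _)
  have habs : |k| ≤ k ^ 2 := by
    rw [← sq_abs]
    exact Int.le_self_sq _
  refine ⟨k, abs_le.mp (habs.trans hsq), ?_⟩
  change (k : ℚ) / N = v i
  rw [hkv, mul_div_cancel_left₀ _ hNQ]

/-- Each coordinate of a vector is bounded in terms of a positive definite form. -/
theorem IsPosDefForm.exists_sq_apply_le {m : ℕ} {F : Matrix (Fin m) (Fin m) ℚ}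
    (hF : IsPosDefForm F) (i : Fin m) :
    ∃ c : ℚ, ∀ v : Fin m → ℚ, v i ^ 2 ≤ c * (v ⬝ᵥ F *ᵥ v) := by
  have hinj : Function.Injective F.mulVecLin := by
    refine (injective_iff_map_eq_zero _).2 fun v hv => ?_
    by_contra hne
    have := hF.2 v hne
    rw [← Matrix.mulVecLin_apply, hv, dotProduct_zero] at this
    exact this.false
  obtain ⟨w, hw⟩ := LinearMap.injective_iff_surjective.1 hinj (Pi.single i 1)
  have hsymm : ∀ x y, x ⬝ᵥ F *ᵥ y = y ⬝ᵥ F *ᵥ x := fun x y => by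
    rw [dotProduct_mulVec, ← mulVec_transpose, hF.1, dotProduct_comm]
  refine ⟨w ⬝ᵥ F *ᵥ w, fun v => ?_⟩
  have hcoord : w ⬝ᵥ F *ᵥ v = v i := by
    rw [hsymm, ← Matrix.mulVecLin_apply, hw, dotProduct_single, mul_one]
  have h := LinearMap.BilinForm.apply_sq_le_of_symm (Matrix.toBilin' F)
    (fun x => by
      rw [Matrix.toBilin'_apply']
      by_cases hx : x = 0
      · simp [hx]
      · exact (hF.2 x hx).le)
    ⟨fun x y => by simpa only [Matrix.toBilin'_apply', RingHom.id_apply] using hsymm x y⟩ w v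
  simpa only [Matrix.toBilin'_apply', hcoord] using h

/-- A lattice has only finitely many vectors of a given norm. -/
theorem IsPosDefForm.finite_setOf_norm_eq {m : ℕ} {F : Matrix (Fin m) (Fin m) ℚ}
    (hF : IsPosDefForm F) {L : Submodule ℤ (Fin m → ℚ)} (hL : L.FG) (c : ℚ) :
    {v | v ∈ L ∧ v ⬝ᵥ F *ᵥ v = c}.Finite := by
  choose b hb using hF.exists_sq_apply_le
  refine (hL.finite_setOf_sq_le fun i => b i * c).subset ?_
  rintro v ⟨hv, rfl⟩
  exact ⟨hv, fun i => hb i v⟩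

/-- The automorphism group of a full lattice with a positive definite form is finite. -/
theorem finite_autSet {m : ℕ} {L : Submodule ℤ (Fin m → ℚ)} {F : Matrix (Fin m) (Fin m) ℚ}
    (hL : L.FG) (hspan : Submodule.span ℚ (L : Set (Fin m → ℚ)) = ⊤) (hF : IsPosDefForm F) :
    (autSet L F).Finite := by
  obtain ⟨S, rfl⟩ := hL
  have hL : (Submodule.span ℤ (S : Set (Fin m → ℚ))).FG := ⟨S, rfl⟩
  refine Set.Finite.of_finite_image (f := fun (g : GL (Fin m) ℚ) (s : S) =>
    (s : Fin m → ℚ) ᵥ* (g : Matrix (Fin m) (Fin m) ℚ)) ?_ ?_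
  · refine (Set.Finite.pi' fun s : S => hF.finite_setOf_norm_eq hL
      ((s : Fin m → ℚ) ⬝ᵥ F *ᵥ (s : Fin m → ℚ))).subset ?_
    rintro _ ⟨g, ⟨hgL, hgF⟩, rfl⟩ s
    refine ⟨hgL.subset ⟨s, Submodule.subset_span s.2, rfl⟩, ?_⟩
    conv_rhs => rw [← hgF]
    rw [← mulVec_mulVec, mulVec_transpose, ← mulVec_mulVec]
    exact (dotProduct_mulVec _ _ _).symm
  · intro g _ h _ hgh
    have hS : Submodule.span ℚ (S : Set (Fin m → ℚ)) = ⊤ := by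
      rwa [Submodule.span_span_of_tower] at hspan
    have heq : Matrix.vecMulLinear (g : Matrix (Fin m) (Fin m) ℚ) =
        Matrix.vecMulLinear (h : Matrix (Fin m) (Fin m) ℚ) :=
      LinearMap.ext_on hS fun s hs => congrFun hgh ⟨s, hs⟩
    refine Units.ext (Matrix.ext_iff_vecMul.2 fun v => ?_)
    exact congrArg (· v) heq

/-- The automorphism group of a lattice with a form, as a subgroup. -/
def autSubgroup {m : ℕ} (L : Submodule ℤ (Fin m → ℚ)) (F : Matrix (Fin m) (Fin m) ℚ) :
    Subgroup (GL (Fin m) ℚ) where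
  carrier := autSet L F
  one_mem' := by simp [autSet]
  mul_mem' := by
    rintro g h ⟨hgL, hgF⟩ ⟨hhL, hhF⟩
    refine ⟨?_, ?_⟩
    · simp only [Units.val_mul, ← vecMul_vecMul]
      rw [← Set.image_image (fun v => v ᵥ* (h : Matrix (Fin m) (Fin m) ℚ)), hgL, hhL]
    · rw [Units.val_mul, transpose_mul]
      calc _ = (g : Matrix (Fin m) (Fin m) ℚ) *
            ((h : Matrix (Fin m) (Fin m) ℚ) * F * (h : Matrix (Fin m) (Fin m) ℚ)ᵀ) *
            (g : Matrix (Fin m) (Fin m) ℚ)ᵀ := by simp only [Matrix.mul_assoc]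
        _ = F := by rw [hhF, hgF]
  inv_mem' := by
    rintro g ⟨hgL, hgF⟩
    have hinv : ((g⁻¹ : GL (Fin m) ℚ) : Matrix (Fin m) (Fin m) ℚ) * g = 1 := by
      rw [← Units.val_mul, inv_mul_cancel, Units.val_one]
    have hinv' : (g : Matrix (Fin m) (Fin m) ℚ) * (g⁻¹ : GL (Fin m) ℚ) = 1 := by
      rw [← Units.val_mul, mul_inv_cancel, Units.val_one]
    refine ⟨?_, ?_⟩
    · conv_lhs => rw [← hgL]
      rw [Set.image_image]
      simp only [vecMul_vecMul, hinv', vecMul_one, Set.image_id']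
    · conv_lhs => rw [← hgF]
      calc _ = ((g⁻¹ : GL (Fin m) ℚ) : Matrix (Fin m) (Fin m) ℚ) *
            (g : Matrix (Fin m) (Fin m) ℚ) * F *
            (((g⁻¹ : GL (Fin m) ℚ) : Matrix (Fin m) (Fin m) ℚ) *
            (g : Matrix (Fin m) (Fin m) ℚ))ᵀ := by
            rw [transpose_mul]; simp only [Matrix.mul_assoc]
        _ = F := by rw [hinv, transpose_one, Matrix.one_mul, Matrix.mul_one]

/-- A group preserving a lattice and a form is contained in their automorphism group. -/
theorem le_autSubgroup {m : ℕ} {G : Subgroup (GL (Fin m) ℚ)} {L : Submodule ℤ (Fin m → ℚ)}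
    {F : Matrix (Fin m) (Fin m) ℚ} (hL : IsFullInvariantLattice G L)
    (hF : IsInvariantForm G F) : G ≤ autSubgroup L F := by
  intro g hg
  refine ⟨Set.Subset.antisymm ?_ fun v hv => ?_, hF g hg⟩
  · rintro _ ⟨v, hv, rfl⟩
    exact hL.2.2 g hg v hv
  · refine ⟨_, hL.2.2 g⁻¹ (inv_mem hg) v hv, ?_⟩
    simp only [vecMul_vecMul]
    rw [← Units.val_mul, inv_mul_cancel, Units.val_one, vecMul_one]

/-- A finite rational matrix group has a positive definite invariant form. -/
theorem exists_isPosDefForm_isInvariantForm {m : ℕ} (H : Subgroup (GL (Fin m) ℚ)) [Finite H] :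
    ∃ F, IsPosDefForm F ∧ IsInvariantForm H F := by
  have := Fintype.ofFinite H
  let M : H → Matrix (Fin m) (Fin m) ℚ := fun h => ((h : GL (Fin m) ℚ) : Matrix (Fin m) (Fin m) ℚ)
  refine ⟨∑ h, M h * (M h)ᵀ, ⟨?_, fun v hv => ?_⟩, fun g hg => ?_⟩
  · simp only [transpose_sum, transpose_mul, transpose_transpose]
  · have hterm : ∀ h, v ⬝ᵥ (M h * (M h)ᵀ) *ᵥ v = (v ᵥ* M h) ⬝ᵥ (v ᵥ* M h) := fun h => by
      rw [← mulVec_mulVec, mulVec_transpose, dotProduct_mulVec]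
    have hnonneg : ∀ w : Fin m → ℚ, 0 ≤ w ⬝ᵥ w := fun w =>
      Finset.sum_nonneg fun i _ => mul_self_nonneg (w i)
    rw [sum_mulVec, dotProduct_sum]
    refine Finset.sum_pos' (fun h _ => by rw [hterm]; exact hnonneg _)
      ⟨1, Finset.mem_univ _, ?_⟩
    have hone : M 1 = 1 := rfl
    rw [hterm, hone, vecMul_one]
    exact lt_of_le_of_ne (hnonneg v) fun h => hv (dotProduct_self_eq_zero.1 h.symm)
  · rw [Finset.mul_sum, Finset.sum_mul]
    refine Fintype.sum_equiv (Equiv.mulLeft (⟨g, hg⟩ : H)) _ _ fun h => ?_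
    have hmul : M (Equiv.mulLeft (⟨g, hg⟩ : H) h) = (g : Matrix (Fin m) (Fin m) ℚ) * M h := rfl
    rw [hmul, transpose_mul]
    simp only [Matrix.mul_assoc]

/-- A finite rational matrix group has a full invariant lattice. -/
theorem exists_isFullInvariantLattice {m : ℕ} (H : Subgroup (GL (Fin m) ℚ)) [Finite H] :
    ∃ L, IsFullInvariantLattice H L := by
  let r : H × Fin m → Fin m → ℚ := fun p => ((p.1 : GL (Fin m) ℚ) : Matrix (Fin m) (Fin m) ℚ) p.2
  refine ⟨Submodule.span ℤ (Set.range r), Submodule.fg_span (Set.finite_range r), ?_, ?_⟩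
  · rw [Submodule.span_span_of_tower, eq_top_iff, ← (Pi.basisFun ℚ (Fin m)).span_eq]
    refine Submodule.span_mono ?_
    rintro _ ⟨i, rfl⟩
    refine ⟨(1, i), ?_⟩
    ext j
    simp [r, Matrix.one_apply, Pi.single_apply, eq_comm]
  · intro g hg
    refine Submodule.span_le (p := (Submodule.span ℤ (Set.range r)).comap
      ((Matrix.vecMulLinear (g : Matrix (Fin m) (Fin m) ℚ)).restrictScalars ℤ)).2 ?_
    rintro _ ⟨⟨h, i⟩, rfl⟩
    exact Submodule.subset_span ⟨(h * ⟨g, hg⟩, i), Matrix.mul_apply_eq_vecMul _ _ i⟩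

/-- A finite subgroup `G ≤ GL_m(ℚ)` is maximal finite if and only if `G = Aut(L, F)` for
every full `G`-invariant lattice `L` and every positive definite `G`-invariant form `F`. -/
theorem maximalFinite_iff_aut {m : ℕ} (G : Subgroup (GL (Fin m) ℚ))
    (hG : (G : Set (GL (Fin m) ℚ)).Finite) :
    (∀ H : Subgroup (GL (Fin m) ℚ), (H : Set (GL (Fin m) ℚ)).Finite → G ≤ H → H = G) ↔
      (∀ (L : Submodule ℤ (Fin m → ℚ)) (F : Matrix (Fin m) (Fin m) ℚ),
        IsFullInvariantLattice G L → IsPosDefForm F → IsInvariantForm G F →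
          (G : Set (GL (Fin m) ℚ)) = autSet L F) := by
  constructor
  · intro hmax L F hL hF hGF
    have hfin : (autSubgroup L F : Set (GL (Fin m) ℚ)).Finite := finite_autSet hL.1 hL.2.1 hF
    exact congrArg _ (hmax _ hfin (le_autSubgroup hL hGF)).symm
  · intro haut H hH hGH
    have : Finite H := hH
    obtain ⟨F, hF, hHF⟩ := exists_isPosDefForm_isInvariantForm H
    obtain ⟨L, hL⟩ := exists_isFullInvariantLattice H
    have hG_eq := haut L F ⟨hL.1, hL.2.1, fun g hg => hL.2.2 g (hGH hg)⟩ hF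
      fun g hg => hHF g (hGH hg)
    refine le_antisymm (fun g hg => ?_) hGH
    exact hG_eq.superset (le_autSubgroup hL hHF hg)
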